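/- arXiv:1609.09374 — 3 statements merged into one kernel-verified Lean document; each statement's English description precedes it below -/
import Mathlib

section
/- Let T be a finite tree with vertex set V and adjacency matrix A, and let λ ∈ ℝ. If there exists φ : V → ℝ with φ(o) ≠ 0 for every o ∈ V and Aφ = λφ, then the eigenvalue λ is simple: the kernel of A − λI is one-dimensional. -/
open Matrix

/-- An antisymmetric, divergence-free flow on the edges of a finite acyclic graph vanishes. -/
theorem SimpleGraph.IsAcyclic.flow_eq_zero {V : Type*} [Fintype V] {G : SimpleGraph V}
    [DecidableRel G.Adj] (hG : G.IsAcyclic) {f : V → V → ℝ} (hf : ∀ x y, f x y = -f y x)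
    (hdiv : ∀ x, ∑ y, (if G.Adj x y then f x y else 0) = 0) {u v : V} (huv : G.Adj u v) :
    f u v = 0 := by
  classical
  have hb := SimpleGraph.isAcyclic_iff_forall_adj_isBridge.mp hG huv
  set H := G.deleteEdges {s(u, v)}
  have hnr : ¬ H.Reachable u v := SimpleGraph.isBridge_iff.mp hb
  have hstep : ∀ x y, G.Adj x y → H.Reachable u x → ¬ H.Reachable u y → x = u ∧ y = v := by
    intro x y hxy hx hy
    by_cases he : s(x, y) = s(u, v)
    · rcases Sym2.eq_iff.mp he with h | ⟨rfl, rfl⟩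
      · exact h
      · exact absurd (SimpleGraph.Reachable.refl _) hy
    · exact absurd (hx.trans (SimpleGraph.Adj.reachable
        (SimpleGraph.deleteEdges_adj.mpr ⟨hxy, he⟩))) hy
  let g : V → V → ℝ := fun x y =>
    if H.Reachable u x ∧ H.Reachable u y ∧ G.Adj x y then f x y else 0
  have hg : ∑ x, ∑ y, g x y = 0 := by
    have hanti : ∀ x y, g x y = -g y x := by
      intro x y
      have hiff : (H.Reachable u x ∧ H.Reachable u y ∧ G.Adj x y) ↔
          (H.Reachable u y ∧ H.Reachable u x ∧ G.Adj y x) := by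
        rw [G.adj_comm]; tauto
      simp only [g, hiff]
      split_ifs
      · exact hf x y
      · simp
    have h : ∑ x, ∑ y, g x y = -∑ x, ∑ y, g x y := by
      conv_lhs => rw [Finset.sum_comm]
      simp only [← Finset.sum_neg_distrib]
      exact Finset.sum_congr rfl fun x _ => Finset.sum_congr rfl fun y _ => hanti y x
    linarith
  have hsplit : ∀ x y, (if H.Reachable u x then (if G.Adj x y then f x y else 0) else 0) =
      g x y + if x = u then (if y = v then f u v else 0) else 0 := by
    intro x y
    by_cases hx : H.Reachable u x
    · by_cases hy : H.Reachable u y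
      · have : y ≠ v := fun h => hnr (h ▸ hy)
        simp [g, hx, hy, this]
      · by_cases hxy : G.Adj x y
        · obtain ⟨rfl, rfl⟩ := hstep x y hxy hx hy
          simp [g, hnr, hxy]
        · have : ¬ (x = u ∧ y = v) := by rintro ⟨rfl, rfl⟩; exact hxy huv
          simp [g, hxy, ← ite_and, this]
    · have : x ≠ u := fun h => hx (h ▸ SimpleGraph.Reachable.refl _)
      simp [g, hx, this]
  have htotal : ∑ x, ∑ y, (if H.Reachable u x then (if G.Adj x y then f x y else 0) else 0) =
      0 := by
    refine Finset.sum_eq_zero fun x _ => ?_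
    by_cases hx : H.Reachable u x
    · simpa [hx] using hdiv x
    · simp [hx]
  simp only [hsplit, Finset.sum_add_distrib, hg, zero_add] at htotal
  rw [Finset.sum_eq_single u (fun x _ hx => by simp [hx]) (by simp)] at htotal
  simpa using htotal

/-- If a finite tree `T` with adjacency matrix `A` admits a nowhere-vanishing
eigenfunction for the eigenvalue `λ`, then `λ` is a simple eigenvalue: the kernel of `A - λI`
is one-dimensional. -/
theorem stmt_4 {V : Type*} [Fintype V] [DecidableEq V]
    (G : SimpleGraph V) [DecidableRel G.Adj] (hG : G.IsTree) (lam : ℝ)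
    (φ : V → ℝ) (hφ : ∀ o : V, φ o ≠ 0)
    (heig : G.adjMatrix ℝ *ᵥ φ = lam • φ) :
    Module.finrank ℝ
      (LinearMap.ker (Matrix.toLin' (G.adjMatrix ℝ - lam • 1))) = 1 := by
  have hmem : ∀ ψ : V → ℝ, ψ ∈ LinearMap.ker (Matrix.toLin' (G.adjMatrix ℝ - lam • 1)) ↔
      G.adjMatrix ℝ *ᵥ ψ = lam • ψ := fun ψ => by
    rw [LinearMap.mem_ker, Matrix.toLin'_apply, Matrix.sub_mulVec, Matrix.smul_mulVec,
      Matrix.one_mulVec, sub_eq_zero]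
  have hsum : ∀ ψ : V → ℝ, G.adjMatrix ℝ *ᵥ ψ = lam • ψ → ∀ x,
      ∑ y, (if G.Adj x y then ψ y else 0) = lam * ψ x := fun ψ hψ x => by
    simpa [Matrix.mulVec, dotProduct, SimpleGraph.adjMatrix_apply] using congrFun hψ x
  obtain ⟨o⟩ := hG.connected.nonempty
  refine finrank_eq_one_iff_of_nonzero' ⟨φ, (hmem φ).mpr heig⟩
    (fun h => hφ o (congrFun (congrArg Subtype.val h) o)) |>.mpr ?_
  rintro ⟨ψ, hψ⟩
  have hflow : ∀ u v, G.Adj u v → φ u * ψ v - ψ u * φ v = 0 := fun u v huv => by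
    refine hG.isAcyclic.flow_eq_zero (f := fun x y => φ x * ψ y - ψ x * φ y)
      (fun x y => by ring) (fun x => ?_) huv
    calc ∑ y, (if G.Adj x y then φ x * ψ y - ψ x * φ y else 0)
        = φ x * ∑ y, (if G.Adj x y then ψ y else 0) -
          ψ x * ∑ y, (if G.Adj x y then φ y else 0) := by
          rw [Finset.mul_sum, Finset.mul_sum, ← Finset.sum_sub_distrib]
          refine Finset.sum_congr rfl fun y _ => ?_
          split_ifs <;> simp
      _ = 0 := by rw [hsum ψ ((hmem ψ).mp hψ), hsum φ heig]; ring
  have hratio : ∀ x, ψ o / φ o = ψ x / φ x := fun x => by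
    obtain ⟨p⟩ := hG.connected.preconnected o x
    induction p with
    | nil => rfl
    | cons h _ ih =>
      rw [← ih, div_eq_div_iff (hφ _) (hφ _)]
      linarith [hflow _ _ h]
  refine ⟨ψ o / φ o, Subtype.ext (funext fun x => ?_)⟩
  change ψ o / φ o * φ x = ψ x
  rw [hratio x, div_mul_cancel₀ _ (hφ x)]
end

section
/- Let μ be a finite Borel measure on ℝ with Stieltjes transform s_μ, let λ ∈ ℝ, and let ν be a Borel probability measure on ℝ whose Stieltjes transform satisfies s_ν(z) = −1/(z + s_μ(z)) for all z in the upper half-plane. If μ({λ}) = 0, β := ∫_ℝ (ξ − λ)^{−2} dμ(ξ) < ∞, and γ := ∫_ℝ (ξ − λ)^{−1} dμ(ξ) ≠ −λ, then ν({λ}) = 0, ∫_ℝ (ξ − λ)^{−2} dν(ξ) = (1 + β)/(λ + γ)², and ∫_ℝ (ξ − λ)^{−1} dν(ξ) = −1/(λ + γ). -/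
open MeasureTheory Filter Topology

/-- The integrals of `((ξ - a) ^ 2 + η ^ 2)⁻¹` increase to the integral of `(ξ - a)⁻²` as `η`
decreases to `0` along the sequence `1 / (n + 1)`. -/
lemma tendsto_lintegral_inv_sq_add_sq (m : Measure ℝ) (a : ℝ) :
    Tendsto (fun n : ℕ => ∫⁻ ξ : ℝ,
        (ENNReal.ofReal ((ξ - a) ^ 2 + (1 / ((n : ℝ) + 1)) ^ 2))⁻¹ ∂m) atTop
      (𝓝 (∫⁻ ξ : ℝ, (ENNReal.ofReal ((ξ - a) ^ 2))⁻¹ ∂m)) := by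
  refine lintegral_tendsto_of_tendsto_of_monotone (fun n => by fun_prop) ?_ ?_
  · refine Eventually.of_forall fun ξ n k hnk => ?_
    have h : 1 / ((k : ℝ) + 1) ≤ 1 / ((n : ℝ) + 1) := Nat.one_div_le_one_div hnk
    have h0 : 0 ≤ 1 / ((k : ℝ) + 1) := by positivity
    refine ENNReal.inv_le_inv.2 (ENNReal.ofReal_le_ofReal ?_)
    gcongr
  · refine Eventually.of_forall fun ξ => ?_
    refine tendsto_inv_iff.2 (ENNReal.tendsto_ofReal ?_)
    have h := (tendsto_one_div_add_atTop_nhds_zero_nat (𝕜 := ℝ)).pow 2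
    simpa using h.const_add ((ξ - a) ^ 2)

lemma norm_inv_ofReal_sub_le_inv_im (a : ℝ) {η : ℝ} (hη : 0 < η) (ξ : ℝ) :
    ‖((ξ : ℂ) - ⟨a, η⟩)⁻¹‖ ≤ η⁻¹ := by
  rw [norm_inv]
  refine inv_anti₀ hη ?_
  simpa [abs_of_pos hη] using Complex.abs_im_le_norm ((ξ : ℂ) - ⟨a, η⟩)

lemma integrable_inv_ofReal_sub (m : Measure ℝ) [IsFiniteMeasure m] (a : ℝ) {η : ℝ}
    (hη : 0 < η) : Integrable (fun ξ : ℝ => ((ξ : ℂ) - ⟨a, η⟩)⁻¹) m :=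
  .of_bound (by fun_prop) η⁻¹ (Eventually.of_forall (norm_inv_ofReal_sub_le_inv_im a hη))

/-- The imaginary part of the Stieltjes transform as a Poisson integral. -/
lemma ofReal_im_stieltjes_div (m : Measure ℝ) [IsFiniteMeasure m] (a : ℝ) {η : ℝ}
    (hη : 0 < η) :
    ENNReal.ofReal ((∫ ξ : ℝ, ((ξ : ℂ) - ⟨a, η⟩)⁻¹ ∂m).im / η)
      = ∫⁻ ξ : ℝ, (ENNReal.ofReal ((ξ - a) ^ 2 + η ^ 2))⁻¹ ∂m := by
  have hint := integrable_inv_ofReal_sub m a hη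
  have him : (∫ ξ : ℝ, ((ξ : ℂ) - ⟨a, η⟩)⁻¹ ∂m).im
      = ∫ ξ : ℝ, (((ξ : ℂ) - ⟨a, η⟩)⁻¹).im ∂m := (integral_im hint).symm
  have hpt (ξ : ℝ) : (((ξ : ℂ) - ⟨a, η⟩)⁻¹).im / η = ((ξ - a) ^ 2 + η ^ 2)⁻¹ := by
    simp only [Complex.inv_im, Complex.sub_im, Complex.ofReal_im, Complex.normSq_apply,
      Complex.sub_re, Complex.ofReal_re]
    have hsq : (ξ - a) * (ξ - a) + (0 - η) * (0 - η) = (ξ - a) ^ 2 + η ^ 2 := by ring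
    rw [hsq]
    field_simp
    ring
  rw [him, ← integral_div, ofReal_integral_eq_lintegral_ofReal]
  · refine lintegral_congr fun ξ => ?_
    rw [hpt, ENNReal.ofReal_inv_of_pos (by positivity)]
  · exact hint.im.div_const η
  · exact Eventually.of_forall fun ξ => by
      simp only [hpt, Pi.zero_apply]
      positivity

lemma ae_ne_of_lintegral_inv_sq_ne_top {m : Measure ℝ} {a : ℝ}
    (h : (∫⁻ ξ : ℝ, (ENNReal.ofReal ((ξ - a) ^ 2))⁻¹ ∂m) ≠ ⊤) : ∀ᵐ ξ ∂m, ξ ≠ a := by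
  filter_upwards [ae_lt_top (by fun_prop) h] with ξ hξ hξa
  simp [hξa] at hξ

lemma integrable_inv_sub_of_lintegral_inv_sq_ne_top {m : Measure ℝ} [IsFiniteMeasure m] {a : ℝ}
    (h : (∫⁻ ξ : ℝ, (ENNReal.ofReal ((ξ - a) ^ 2))⁻¹ ∂m) ≠ ⊤) :
    Integrable (fun ξ : ℝ => (ξ - a)⁻¹) m := by
  have hmeas : Measurable fun ξ : ℝ => (ξ - a)⁻¹ := by fun_prop
  refine MemLp.integrable (q := 2) (by norm_num)
    ((memLp_two_iff_integrable_sq hmeas.aestronglyMeasurable).2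
      ⟨(hmeas.pow_const 2).aestronglyMeasurable, ?_⟩)
  rw [hasFiniteIntegral_iff_ofReal (Eventually.of_forall fun ξ => sq_nonneg _)]
  refine lt_of_eq_of_lt (lintegral_congr_ae ?_) h.lt_top
  filter_upwards [ae_ne_of_lintegral_inv_sq_ne_top h] with ξ hξ
  have : ξ - a ≠ 0 := sub_ne_zero.2 hξ
  rw [inv_pow, ENNReal.ofReal_inv_of_pos (by positivity)]

lemma tendsto_mk_one_div (a : ℝ) :
    Tendsto (fun n : ℕ => (⟨a, 1 / ((n : ℝ) + 1)⟩ : ℂ)) atTop (𝓝 (a : ℂ)) := by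
  have h := (Complex.continuous_ofReal.tendsto 0).comp
    (tendsto_one_div_add_atTop_nhds_zero_nat (𝕜 := ℝ))
  have h' := (h.mul_const Complex.I).const_add (a : ℂ)
  simp only [Complex.ofReal_zero, zero_mul, add_zero] at h'
  refine h'.congr fun n => ?_
  rw [Function.comp_apply, ← Complex.mk_eq_add_mul_I]

/-- The Stieltjes transform has the boundary value `∫ (ξ - a)⁻¹ dm(ξ)` at `a`. -/
lemma tendsto_stieltjes_of_lintegral_inv_sq_ne_top {m : Measure ℝ} [IsFiniteMeasure m] {a : ℝ}
    (h : (∫⁻ ξ : ℝ, (ENNReal.ofReal ((ξ - a) ^ 2))⁻¹ ∂m) ≠ ⊤) :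
    Tendsto (fun n : ℕ => ∫ ξ : ℝ, ((ξ : ℂ) - ⟨a, 1 / ((n : ℝ) + 1)⟩)⁻¹ ∂m) atTop
      (𝓝 ((∫ ξ : ℝ, (ξ - a)⁻¹ ∂m : ℝ) : ℂ)) := by
  rw [← integral_complex_ofReal]
  refine tendsto_integral_of_dominated_convergence (fun ξ => |(ξ - a)⁻¹|)
    (fun n => by fun_prop) (integrable_inv_sub_of_lintegral_inv_sq_ne_top h).abs
    (fun n => ?_) ?_
  · filter_upwards [ae_ne_of_lintegral_inv_sq_ne_top h] with ξ hξ
    rw [norm_inv, abs_inv]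
    refine inv_anti₀ (abs_pos.2 (sub_ne_zero.2 hξ)) ?_
    simpa using Complex.abs_re_le_norm ((ξ : ℂ) - ⟨a, 1 / ((n : ℝ) + 1)⟩)
  · filter_upwards [ae_ne_of_lintegral_inv_sq_ne_top h] with ξ hξ
    have hne : (ξ : ℂ) - a ≠ 0 := by
      rw [← Complex.ofReal_sub]
      exact Complex.ofReal_ne_zero.2 (sub_ne_zero.2 hξ)
    have hz := tendsto_mk_one_div a
    simpa using (hz.const_sub (ξ : ℂ)).inv₀ hne

lemma im_stieltjes_nonneg (m : Measure ℝ) [IsFiniteMeasure m] (a : ℝ) {η : ℝ} (hη : 0 < η) :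
    0 ≤ (∫ ξ : ℝ, ((ξ : ℂ) - ⟨a, η⟩)⁻¹ ∂m).im := by
  have him : (∫ ξ : ℝ, ((ξ : ℂ) - ⟨a, η⟩)⁻¹ ∂m).im
      = ∫ ξ : ℝ, (((ξ : ℂ) - ⟨a, η⟩)⁻¹).im ∂m :=
    (integral_im (integrable_inv_ofReal_sub m a hη)).symm
  rw [him]
  refine integral_nonneg fun ξ => ?_
  simp only [Pi.zero_apply, Complex.inv_im, Complex.sub_im, Complex.ofReal_im, zero_sub, neg_neg]
  exact div_nonneg hη.le (Complex.normSq_nonneg _)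

lemma ofReal_im_neg_one_div_add_div (a : ℝ) {η : ℝ} (hη : 0 < η) {s : ℂ} (hs : 0 ≤ s.im) :
    ENNReal.ofReal ((-1 / (⟨a, η⟩ + s)).im / η)
      = (1 + ENNReal.ofReal (s.im / η)) / ENNReal.ofReal (Complex.normSq (⟨a, η⟩ + s)) := by
  have hne : (⟨a, η⟩ + s : ℂ) ≠ 0 := fun h => by
    have := congrArg Complex.im h
    simp only [Complex.add_im, Complex.zero_im] at this
    linarith
  have hpos : 0 < Complex.normSq (⟨a, η⟩ + s) := Complex.normSq_pos.2 hne
  rw [← ENNReal.ofReal_one, ← ENNReal.ofReal_add zero_le_one (by positivity),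
    ← ENNReal.ofReal_div_of_pos hpos]
  congr 1
  have him : (-1 / (⟨a, η⟩ + s) : ℂ).im = (η + s.im) / Complex.normSq (⟨a, η⟩ + s) := by
    rw [neg_div, one_div, Complex.neg_im, Complex.inv_im, Complex.add_im, neg_div, neg_neg]
  rw [him]
  field_simp

/-- Let `μ` be a finite Borel measure on `ℝ` with Stieltjes transform
`s_μ`, `λ ∈ ℝ`, and let `ν` be a Borel probability measure with `s_ν(z) = -1/(z + s_μ(z))`
on the upper half-plane. If `μ({λ}) = 0`, `β := ∫ (ξ - λ)⁻² dμ(ξ) < ∞`, and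
`γ := ∫ (ξ - λ)⁻¹ dμ(ξ) ≠ -λ`, then `ν({λ}) = 0`,
`∫ (ξ - λ)⁻² dν(ξ) = (1 + β)/(λ + γ)²`, and `∫ (ξ - λ)⁻¹ dν(ξ) = -1/(λ + γ)`
(with `ξ ↦ (ξ - λ)⁻¹ ` being `ν`-integrable). -/
theorem stmt_16 (μ : Measure ℝ) [IsFiniteMeasure μ] (lam : ℝ)
    (ν : Measure ℝ) [IsProbabilityMeasure ν]
    (hν : ∀ z : ℂ, 0 < z.im →
      (∫ ξ : ℝ, ((ξ : ℂ) - z)⁻¹ ∂ν) = -1 / (z + ∫ ξ : ℝ, ((ξ : ℂ) - z)⁻¹ ∂μ))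
    (hα : μ {lam} = 0)
    (hβ : (∫⁻ ξ : ℝ, (ENNReal.ofReal ((ξ - lam) ^ 2))⁻¹ ∂μ) ≠ ⊤)
    (hγ : (∫ ξ : ℝ, (ξ - lam)⁻¹ ∂μ) ≠ -lam) :
    ν {lam} = 0 ∧
    (∫⁻ ξ : ℝ, (ENNReal.ofReal ((ξ - lam) ^ 2))⁻¹ ∂ν)
      = (1 + ∫⁻ ξ : ℝ, (ENNReal.ofReal ((ξ - lam) ^ 2))⁻¹ ∂μ)
          / ENNReal.ofReal ((lam + ∫ ξ : ℝ, (ξ - lam)⁻¹ ∂μ) ^ 2) ∧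
    Integrable (fun ξ : ℝ => (ξ - lam)⁻¹) ν ∧
    (∫ ξ : ℝ, (ξ - lam)⁻¹ ∂ν) = -1 / (lam + ∫ ξ : ℝ, (ξ - lam)⁻¹ ∂μ) := by
  have hη (n : ℕ) : 0 < 1 / ((n : ℝ) + 1) := Nat.one_div_pos_of_nat
  set γ := ∫ ξ : ℝ, (ξ - lam)⁻¹ ∂μ
  have hne : lam + γ ≠ 0 := fun h => hγ (by linarith)
  have hneC : (lam : ℂ) + (γ : ℂ) ≠ 0 := by exact_mod_cast hne
  have hden : Tendsto (fun n : ℕ => (⟨lam, 1 / ((n : ℝ) + 1)⟩ : ℂ)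
      + ∫ ξ : ℝ, ((ξ : ℂ) - ⟨lam, 1 / ((n : ℝ) + 1)⟩)⁻¹ ∂μ) atTop (𝓝 ((lam : ℂ) + γ)) :=
    (tendsto_mk_one_div lam).add (tendsto_stieltjes_of_lintegral_inv_sq_ne_top hβ)
  have hnormSq : Tendsto (fun n : ℕ => ENNReal.ofReal (Complex.normSq
      ((⟨lam, 1 / ((n : ℝ) + 1)⟩ : ℂ)
        + ∫ ξ : ℝ, ((ξ : ℂ) - ⟨lam, 1 / ((n : ℝ) + 1)⟩)⁻¹ ∂μ))) atTop
      (𝓝 (ENNReal.ofReal ((lam + γ) ^ 2))) := by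
    refine ENNReal.tendsto_ofReal ?_
    have h := (Complex.continuous_normSq.tendsto _).comp hden
    rwa [← Complex.ofReal_add, Complex.normSq_ofReal, ← pow_two] at h
  have hlim : Tendsto (fun n : ℕ => ∫⁻ ξ : ℝ,
      (ENNReal.ofReal ((ξ - lam) ^ 2 + (1 / ((n : ℝ) + 1)) ^ 2))⁻¹ ∂ν) atTop
      (𝓝 ((1 + ∫⁻ ξ : ℝ, (ENNReal.ofReal ((ξ - lam) ^ 2))⁻¹ ∂μ)
        / ENNReal.ofReal ((lam + γ) ^ 2))) := by
    have hpos : ENNReal.ofReal ((lam + γ) ^ 2) ≠ 0 := by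
      rw [ENNReal.ofReal_ne_zero_iff]
      positivity
    refine (ENNReal.Tendsto.div ((tendsto_lintegral_inv_sq_add_sq μ lam).const_add 1)
      (Or.inr hpos) hnormSq (Or.inl (by simp))).congr fun n => ?_
    rw [← ofReal_im_stieltjes_div ν lam (hη n), ← ofReal_im_stieltjes_div μ lam (hη n),
      hν _ (hη n)]
    exact (ofReal_im_neg_one_div_add_div lam (hη n) (im_stieltjes_nonneg μ lam (hη n))).symm
  have hsq := tendsto_nhds_unique (tendsto_lintegral_inv_sq_add_sq ν lam) hlim
  have hfin : (∫⁻ ξ : ℝ, (ENNReal.ofReal ((ξ - lam) ^ 2))⁻¹ ∂ν) ≠ ⊤ := by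
    rw [hsq]
    refine ENNReal.div_ne_top (ENNReal.add_ne_top.2 ⟨ENNReal.one_ne_top, hβ⟩) ?_
    rw [ENNReal.ofReal_ne_zero_iff]
    positivity
  refine ⟨?_, hsq, integrable_inv_sub_of_lintegral_inv_sq_ne_top hfin, ?_⟩
  · simpa [ae_iff] using ae_ne_of_lintegral_inv_sq_ne_top hfin
  · have h := tendsto_nhds_unique (tendsto_stieltjes_of_lintegral_inv_sq_ne_top hfin)
      ((tendsto_const_nhds (x := (-1 : ℂ)).div hden hneC).congr
        fun n => (hν ⟨lam, 1 / ((n : ℝ) + 1)⟩ (hη n)).symm)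
    exact_mod_cast h
end

section
/- Let μ be a finite Borel measure on ℝ with Stieltjes transform s_μ, let λ ∈ ℝ, and let ν be a Borel probability measure on ℝ whose Stieltjes transform satisfies s_ν(z) = −1/(z + s_μ(z)) for all z in the upper half-plane. If μ({λ}) = 0 and ∫_ℝ (ξ − λ)^{−2} dμ(ξ) = ∞, then ν({λ}) = 0 and ∫_ℝ (ξ − λ)^{−2} dν(ξ) = ∞. -/
open MeasureTheory

open Filter Topology

/-- The Poisson-type integral `∫ ((ξ - a)² + y²)⁻¹ dm(ξ)`. -/
noncomputable def poissonIntegral (m : Measure ℝ) (a y : ℝ) : ℝ :=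
  ∫ ξ, ((ξ - a) ^ 2 + y ^ 2)⁻¹ ∂m

lemma integrable_poissonKernel (m : Measure ℝ) [IsFiniteMeasure m] (a : ℝ) {y : ℝ} (hy : 0 < y) :
    Integrable (fun ξ : ℝ => ((ξ - a) ^ 2 + y ^ 2)⁻¹) m := by
  refine Integrable.of_bound (C := (y ^ 2)⁻¹) (by fun_prop) (.of_forall fun ξ => ?_)
  rw [Real.norm_of_nonneg (by positivity)]
  exact inv_anti₀ (by positivity) (by nlinarith [sq_nonneg (ξ - a)])

lemma integrable_stieltjesKernel (m : Measure ℝ) [IsFiniteMeasure m] {z : ℂ} (hz : 0 < z.im) :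
    Integrable (fun ξ : ℝ => ((ξ : ℂ) - z)⁻¹) m := by
  refine Integrable.of_bound (C := z.im⁻¹) (by fun_prop) (.of_forall fun ξ => ?_)
  rw [norm_inv]
  refine inv_anti₀ hz ?_
  simpa [abs_of_pos hz] using Complex.abs_im_le_norm ((ξ : ℂ) - z)

lemma poissonIntegral_nonneg (m : Measure ℝ) (a y : ℝ) : 0 ≤ poissonIntegral m a y :=
  integral_nonneg fun _ => by positivity

/-- The imaginary part of the Stieltjes transform at `a + iy`. -/
lemma im_stieltjes (m : Measure ℝ) [IsFiniteMeasure m] (a : ℝ) {y : ℝ} (hy : 0 < y) :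
    (∫ ξ : ℝ, ((ξ : ℂ) - ⟨a, y⟩)⁻¹ ∂m).im = y * poissonIntegral m a y := by
  rw [poissonIntegral, ← integral_const_mul]
  have h := integral_im (𝕜 := ℂ) (integrable_stieltjesKernel m (z := ⟨a, y⟩) hy)
  simp only [RCLike.im_to_complex] at h
  rw [← h]
  refine integral_congr_ae (.of_forall fun ξ => ?_)
  simp [Complex.inv_im, Complex.normSq_apply, div_eq_mul_inv, sq]

/-- Monotone convergence for the Poisson integral along `y = 1 / (n + 1)`. -/
lemma tendsto_poissonIntegral_atTop (m : Measure ℝ) [IsFiniteMeasure m] (a : ℝ)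
    (h : (∫⁻ ξ : ℝ, (ENNReal.ofReal ((ξ - a) ^ 2))⁻¹ ∂m) = ⊤) :
    Tendsto (fun n : ℕ => poissonIntegral m a (1 / ((n : ℝ) + 1))) atTop atTop := by
  have hpos (n : ℕ) : (0 : ℝ) < 1 / ((n : ℝ) + 1) := by positivity
  have key : Tendsto (fun n : ℕ => ∫⁻ ξ : ℝ,
      (ENNReal.ofReal ((ξ - a) ^ 2 + (1 / ((n : ℝ) + 1)) ^ 2))⁻¹ ∂m) atTop (𝓝 ⊤) := by
    rw [← h]
    refine lintegral_tendsto_of_tendsto_of_monotone (fun n => by fun_prop)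
      (.of_forall fun ξ n k hnk => ?_) (.of_forall fun ξ => ?_)
    · have := one_div_le_one_div_of_le (by positivity : (0 : ℝ) < (n : ℝ) + 1)
        (by gcongr : (n : ℝ) + 1 ≤ (k : ℝ) + 1)
      dsimp only
      gcongr
    · refine (ENNReal.continuous_ofReal.tendsto _ |>.comp ?_).inv
      simpa using ((tendsto_one_div_add_atTop_nhds_zero_nat (𝕜 := ℝ)).pow 2).const_add ((ξ - a) ^ 2)
  have heq (n : ℕ) : (∫⁻ ξ : ℝ, (ENNReal.ofReal ((ξ - a) ^ 2 + (1 / ((n : ℝ) + 1)) ^ 2))⁻¹ ∂m)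
      = ENNReal.ofReal (poissonIntegral m a (1 / ((n : ℝ) + 1))) := by
    rw [poissonIntegral, ofReal_integral_eq_lintegral_ofReal
      (integrable_poissonKernel m a (hpos n)) (.of_forall fun _ => by positivity)]
    refine lintegral_congr fun ξ => ?_
    rw [ENNReal.ofReal_inv_of_pos (by have := hpos n; positivity)]
  simp only [heq] at key
  exact ENNReal.tendsto_ofReal_nhds_top.1 key

lemma tendsto_sq_mul_poissonIntegral (m : Measure ℝ) [IsFiniteMeasure m] (a : ℝ)
    (h : m {a} = 0) :
    Tendsto (fun n : ℕ => (1 / ((n : ℝ) + 1)) ^ 2 * poissonIntegral m a (1 / ((n : ℝ) + 1)))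
      atTop (𝓝 0) := by
  have hne : ∀ᵐ ξ ∂m, ξ ≠ a := measure_eq_zero_iff_ae_notMem.1 h
  have hy : Tendsto (fun n : ℕ => (1 / ((n : ℝ) + 1)) ^ 2) atTop (𝓝 0) := by
    simpa using (tendsto_one_div_add_atTop_nhds_zero_nat (𝕜 := ℝ)).pow 2
  simp only [poissonIntegral, ← integral_const_mul]
  rw [← integral_zero ℝ ℝ (μ := m)]
  refine tendsto_integral_of_dominated_convergence (fun _ => 1) (fun n => by fun_prop)
    (integrable_const 1) (fun n => .of_forall fun ξ => ?_) ?_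
  · rw [Real.norm_of_nonneg (by positivity), ← div_eq_mul_inv]
    exact div_le_one_of_le₀ (by nlinarith [sq_nonneg (ξ - a)]) (by positivity)
  · filter_upwards [hne] with ξ hξ
    have h0 : (ξ - a) ^ 2 ≠ 0 := pow_ne_zero 2 (sub_ne_zero.2 hξ)
    simpa using hy.mul ((hy.const_add ((ξ - a) ^ 2)).inv₀ (by simpa using h0))

lemma measureReal_singleton_le (m : Measure ℝ) [IsFiniteMeasure m] (a : ℝ) {y : ℝ} (hy : 0 < y) :
    m.real {a} ≤ y ^ 2 * poissonIntegral m a y := by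
  rw [poissonIntegral, ← integral_const_mul, ← integral_indicator_one (measurableSet_singleton a)]
  refine integral_mono ((integrable_const (1 : ℝ)).indicator (measurableSet_singleton a))
    ((integrable_poissonKernel m a hy).const_mul _) fun ξ => ?_
  by_cases hξ : ξ = a
  · simp [hξ, hy.ne']
  · rw [Set.indicator_of_notMem (by simpa using hξ)]
    positivity

lemma poissonIntegral_anti (m : Measure ℝ) [IsFiniteMeasure m] (a : ℝ) {y y' : ℝ}
    (hy : 0 < y) (h : y ≤ y') : poissonIntegral m a y' ≤ poissonIntegral m a y :=
  integral_mono (integrable_poissonKernel m a (hy.trans_le h)) (integrable_poissonKernel m a hy)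
    fun ξ => by dsimp only; gcongr

lemma poissonIntegral_pos (m : Measure ℝ) [IsProbabilityMeasure m] (a : ℝ) {y : ℝ}
    (hy : 0 < y) : 0 < poissonIntegral m a y := by
  rw [poissonIntegral, integral_pos_iff_support_of_nonneg (fun _ => by positivity)
    (integrable_poissonKernel m a hy)]
  have : Function.support (fun ξ : ℝ => ((ξ - a) ^ 2 + y ^ 2)⁻¹) = Set.univ := by
    ext ξ
    simp only [Function.mem_support, Set.mem_univ, iff_true]
    positivity
  simp [this]

/-- Taking imaginary parts in `s = -1 / w`. -/
lemma im_eq_normSq_mul_of_eq_neg_inv {s w : ℂ} (h : s = -1 / w) : s.im = ‖s‖ ^ 2 * w.im := by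
  rw [h, ← Complex.normSq_eq_norm_sq]
  simp [Complex.inv_im, div_eq_mul_inv]
  ring

lemma integrable_inv_sq (m : Measure ℝ) (a : ℝ) (h0 : m {a} = 0)
    (h : (∫⁻ ξ : ℝ, (ENNReal.ofReal ((ξ - a) ^ 2))⁻¹ ∂m) ≠ ⊤) :
    Integrable (fun ξ : ℝ => ((ξ - a) ^ 2)⁻¹) m := by
  have hne : ∀ᵐ ξ ∂m, ξ ≠ a := measure_eq_zero_iff_ae_notMem.1 h0
  refine ⟨by fun_prop, ?_⟩
  rw [hasFiniteIntegral_iff_ofReal (.of_forall fun _ => by positivity)]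
  refine lt_of_eq_of_lt (lintegral_congr_ae ?_) h.lt_top
  filter_upwards [hne] with ξ hξ
  exact ENNReal.ofReal_inv_of_pos (pow_two_pos_of_ne_zero (sub_ne_zero.2 hξ))

/-- If `(ξ - a)⁻²` is integrable, the Stieltjes transform is Lipschitz along `a + iy`. -/
lemma norm_stieltjes_sub_le (m : Measure ℝ) [IsFiniteMeasure m] (a : ℝ) (h0 : m {a} = 0)
    (h : Integrable (fun ξ : ℝ => ((ξ - a) ^ 2)⁻¹) m) {y : ℝ} (hy : 0 < y) :
    ‖(∫ ξ : ℝ, ((ξ : ℂ) - ⟨a, y⟩)⁻¹ ∂m) - ∫ ξ : ℝ, ((ξ : ℂ) - a)⁻¹ ∂m‖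
      ≤ y * ∫ ξ, ((ξ - a) ^ 2)⁻¹ ∂m := by
  have hne : ∀ᵐ ξ ∂m, ξ ≠ a := measure_eq_zero_iff_ae_notMem.1 h0
  have hnorm (ξ : ℝ) : ‖(ξ : ℂ) - a‖ = |ξ - a| := by
    rw [← Complex.ofReal_sub, Complex.norm_real, Real.norm_eq_abs]
  have hint : Integrable (fun ξ : ℝ => ((ξ : ℂ) - a)⁻¹) m := by
    refine (h.add (integrable_const (1 : ℝ))).mono' (by fun_prop) (.of_forall fun ξ => ?_)
    rw [norm_inv, hnorm, Pi.add_apply, ← sq_abs, ← inv_pow]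
    nlinarith [sq_nonneg (|ξ - a|⁻¹ - 1)]
  rw [← integral_sub (integrable_stieltjesKernel m (z := ⟨a, y⟩) hy) hint, ← integral_const_mul]
  refine norm_integral_le_of_norm_le (h.const_mul y) ?_
  filter_upwards [hne] with ξ hξ
  have hpos : 0 < |ξ - a| := abs_pos.2 (sub_ne_zero.2 hξ)
  have hle : |ξ - a| ≤ ‖(ξ : ℂ) - ⟨a, y⟩‖ := by
    simpa using Complex.abs_re_le_norm ((ξ : ℂ) - ⟨a, y⟩)
  have hz1 : (ξ : ℂ) - ⟨a, y⟩ ≠ 0 := norm_pos_iff.1 (hpos.trans_le hle)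
  have hz2 : (ξ : ℂ) - a ≠ 0 := norm_pos_iff.1 (by rwa [hnorm])
  have hnum : ‖((ξ : ℂ) - a) - ((ξ : ℂ) - ⟨a, y⟩)‖ = y := by
    have : ((ξ : ℂ) - a) - ((ξ : ℂ) - ⟨a, y⟩) = y * Complex.I := by
      apply Complex.ext <;> simp
    simp [this, abs_of_pos hy]
  rw [inv_sub_inv hz1 hz2, norm_div, norm_mul, hnum, hnorm, div_eq_mul_inv, ← sq_abs, sq]
  gcongr

/-- Let `μ` be a finite Borel measure on `ℝ` with Stieltjes transform
`s_μ`, `λ ∈ ℝ`, and let `ν` be a Borel probability measure with `s_ν(z) = -1/(z + s_μ(z))`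
on the upper half-plane. If `μ({λ}) = 0` and `∫ (ξ - λ)⁻² dμ(ξ) = ∞`, then `ν({λ}) = 0`
and `∫ (ξ - λ)⁻² dν(ξ) = ∞`. -/
theorem stmt_17 (μ : Measure ℝ) [IsFiniteMeasure μ] (lam : ℝ)
    (ν : Measure ℝ) [IsProbabilityMeasure ν]
    (hν : ∀ z : ℂ, 0 < z.im →
      (∫ ξ : ℝ, ((ξ : ℂ) - z)⁻¹ ∂ν) = -1 / (z + ∫ ξ : ℝ, ((ξ : ℂ) - z)⁻¹ ∂μ))
    (hα : μ {lam} = 0)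
    (hβ : (∫⁻ ξ : ℝ, (ENNReal.ofReal ((ξ - lam) ^ 2))⁻¹ ∂μ) = ⊤) :
    ν {lam} = 0 ∧
    (∫⁻ ξ : ℝ, (ENNReal.ofReal ((ξ - lam) ^ 2))⁻¹ ∂ν) = ⊤ := by
  set y : ℕ → ℝ := fun n => 1 / ((n : ℝ) + 1)
  have hy (n : ℕ) : 0 < y n := by positivity
  have hy1 (n : ℕ) : y n ≤ 1 := div_le_one_of_le₀ (by linarith [n.cast_nonneg (α := ℝ)])
    (by positivity)
  have hy0 : Tendsto y atTop (𝓝 0) := tendsto_one_div_add_atTop_nhds_zero_nat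
  set s : ℕ → ℂ := fun n => ∫ ξ : ℝ, ((ξ : ℂ) - ⟨lam, y n⟩)⁻¹ ∂ν
  set J : ℕ → ℝ := fun n => poissonIntegral μ lam (y n)
  set N : ℕ → ℝ := fun n => poissonIntegral ν lam (y n)
  have hJnn (n : ℕ) : 0 ≤ J n := poissonIntegral_nonneg μ lam (y n)
  have hJ : Tendsto J atTop atTop := tendsto_poissonIntegral_atTop μ lam hβ
  have hsim (n : ℕ) : (s n).im = y n * N n := im_stieltjes ν lam (hy n)
  have hN (n : ℕ) : N n = ‖s n‖ ^ 2 * (1 + J n) := by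
    have h := im_eq_normSq_mul_of_eq_neg_inv (hν ⟨lam, y n⟩ (hy n))
    rw [Complex.add_im, im_stieltjes μ lam (hy n)] at h
    change (s n).im = ‖s n‖ ^ 2 * (y n + y n * J n) at h
    rw [hsim] at h
    exact mul_left_cancel₀ (hy n).ne' (h.trans (by ring))
  have hatom : ν {lam} = 0 := by
    have hbound (n : ℕ) : ν.real {lam} * (1 + J n) ≤ 1 := by
      have h1 : y n * N n ≤ ‖s n‖ := hsim n ▸ (le_abs_self _).trans (Complex.abs_im_le_norm _)
      have hNpos : 0 < N n := poissonIntegral_pos ν lam (hy n)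
      have h2 : (y n * N n) ^ 2 ≤ ‖s n‖ ^ 2 :=
        pow_le_pow_left₀ (mul_pos (hy n) hNpos).le h1 2
      have h3 : N n * (y n ^ 2 * N n * (1 + J n)) ≤ N n * 1 := by
        have := mul_le_mul_of_nonneg_right h2 (by linarith [hJnn n] : 0 ≤ 1 + J n)
        rw [← hN] at this
        linarith
      exact (mul_le_mul_of_nonneg_right (measureReal_singleton_le ν lam (hy n))
        (by linarith [hJnn n])).trans (le_of_mul_le_mul_left h3 hNpos)
    by_contra hne
    have hpos : 0 < ν.real {lam} := by
      rw [measureReal_def]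
      exact ENNReal.toReal_pos hne (measure_ne_top _ _)
    obtain ⟨n, hn⟩ := (((tendsto_atTop_add_const_left _ 1 hJ).const_mul_atTop
      hpos).eventually_gt_atTop 1).exists
    exact absurd (hbound n) (not_le.2 hn)
  refine ⟨hatom, ?_⟩
  by_contra hfin
  have hint := integrable_inv_sq ν lam hatom hfin
  have hne : ∀ᵐ ξ ∂ν, ξ ≠ lam := measure_eq_zero_iff_ae_notMem.1 hatom
  set K : ℝ := ∫ ξ, ((ξ - lam) ^ 2)⁻¹ ∂ν
  set s₀ : ℂ := ∫ ξ : ℝ, ((ξ : ℂ) - lam)⁻¹ ∂ν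
  have hs (n : ℕ) : ‖s n - s₀‖ ≤ y n * K := norm_stieltjes_sub_le ν lam hatom hint (hy n)
  by_cases hs₀ : s₀ = 0
  · have hlim : Tendsto (fun n => K ^ 2 * (y n ^ 2 + y n ^ 2 * J n)) atTop (𝓝 0) := by
      have hyJ : Tendsto (fun n => y n ^ 2 * J n) atTop (𝓝 0) :=
        tendsto_sq_mul_poissonIntegral μ lam hα
      simpa using ((hy0.pow 2).add hyJ).const_mul (K ^ 2)
    refine (poissonIntegral_pos ν lam one_pos).not_ge (ge_of_tendsto' hlim fun n => ?_)
    have h1 : ‖s n‖ ^ 2 ≤ (y n * K) ^ 2 :=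
      pow_le_pow_left₀ (norm_nonneg _) (by simpa [hs₀] using hs n) 2
    calc poissonIntegral ν lam 1 ≤ N n := poissonIntegral_anti ν lam (hy n) (hy1 n)
      _ = ‖s n‖ ^ 2 * (1 + J n) := hN n
      _ ≤ (y n * K) ^ 2 * (1 + J n) := by have := hJnn n; gcongr
      _ = K ^ 2 * (y n ^ 2 + y n ^ 2 * J n) := by ring
  · have hslim : Tendsto s atTop (𝓝 s₀) := by
      rw [tendsto_iff_norm_sub_tendsto_zero]
      exact squeeze_zero (fun _ => norm_nonneg _) hs (by simpa using hy0.mul_const K)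
    have htop : Tendsto N atTop atTop := by
      rw [funext hN]
      exact (hslim.norm.pow 2).pos_mul_atTop (by positivity)
        (tendsto_atTop_add_const_left _ 1 hJ)
    have hNK (n : ℕ) : N n ≤ K := by
      refine integral_mono_ae (integrable_poissonKernel ν lam (hy n)) hint ?_
      filter_upwards [hne] with ξ hξ
      have := pow_two_pos_of_ne_zero (sub_ne_zero.2 hξ)
      exact inv_anti₀ this (by nlinarith [sq_nonneg (y n)])
    obtain ⟨n, hn⟩ := (htop.eventually_gt_atTop K).exists
    exact absurd (hNK n) (not_le.2 hn)
end
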